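/- arXiv:0804.2773 — 2 statements merged into one kernel-verified Lean document; each statement's English description precedes it below -/
import Mathlib

section
/- Let G be a countable amenable group, {I_n} a left Følner sequence in G, and E ⊆ G a set with positive upper density with respect to {I_n}. Then there exist a dynamical system (X, 𝔅, μ, (T_g)_{g∈G}) (a probability measure space with measurable measure-preserving transformations T_g satisfying T_g ∘ T_h = T_{gh}) and a set A ∈ 𝔅 with μ(A) = d̄_{I_n}(E) such that for every k ∈ ℕ and g_1, …, g_k ∈ G, d̄_{I_n}(E ∩ g_1^{-1}E ∩ ⋯ ∩ g_k^{-1}E) ≥ μ(A ∩ T_{g_1}^{-1}A ∩ ⋯ ∩ T_{g_k}^{-1}A). -/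
open Filter MeasureTheory
open scoped Classical symmDiff

/-- `I` is a left Følner sequence in `G`: each `I n` is nonempty, and for every `g ∈ G`
and `ε > 0` there is `M` such that for all `n ≥ M`, `|I n △ g·(I n)| / |I n| < ε`. -/
def IsFolnerSeq {G : Type*} [Mul G] (I : ℕ → Finset G) : Prop :=
  (∀ n, (I n).Nonempty) ∧
    ∀ g : G, ∀ ε > (0 : ℝ), ∃ M, ∀ n ≥ M,
      (((I n) ∆ ((I n).image (fun h => g * h))).card : ℝ) / ((I n).card : ℝ) < ε

/-- The upper density of `E ⊆ G` with respect to the sequence of finite sets `I`: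
`d̄_{I}(E) = limsup_n |E ∩ I n| / |I n|`. -/
noncomputable def upperDensityAlong {G : Type*} (I : ℕ → Finset G) (E : Set G) : ℝ :=
  Filter.limsup (fun n => (((I n).filter (fun g => g ∈ E)).card : ℝ) / ((I n).card : ℝ))
    Filter.atTop

lemma folner_sum_bound {G : Type} [Group G] (S : Finset G) (g : G) (F : G → ℝ) (C : ℝ)
    (hC : ∀ x, |F x| ≤ C) :
    |∑ h ∈ S, F (g * h) - ∑ h ∈ S, F h| ≤
      C * ((S ∆ (S.image (fun h => g * h))).card : ℝ) := by
  have h1 : ∑ h ∈ S, F (g * h) = ∑ x ∈ S.image (fun h => g * h), F x := by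
    rw [Finset.sum_image]
    intro a _ b _ hab
    exact mul_left_cancel hab
  rw [h1]
  set T := S.image (fun h => g * h)
  have h3 : (S ∆ T).card = (T \ S).card + (S \ T).card := by
    rw [symmDiff_def, Finset.sup_eq_union, Finset.card_union_of_disjoint, add_comm]
    exact disjoint_sdiff_sdiff
  have key : ∀ U : Finset G, |∑ x ∈ U, F x| ≤ C * (U.card : ℝ) := by
    intro U
    refine (Finset.abs_sum_le_sum_abs _ _).trans ?_
    refine (Finset.sum_le_sum (fun x _ => hC x)).trans ?_
    simp [mul_comm]
  have h4 := key (T \ S)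
  have h5 := key (S \ T)
  rw [h3]
  push_cast
  have h6 : ∑ x ∈ T, F x - ∑ x ∈ S, F x = ∑ x ∈ T \ S, F x - ∑ x ∈ S \ T, F x := by
    rw [Finset.sum_sdiff_sub_sum_sdiff]
  rw [h6]
  refine (abs_sub _ _).trans ?_
  linarith

/-- Empirical measure. -/
noncomputable def empMeas {G X : Type} [MeasurableSpace X] (S : Finset G) (φ : G → X) :
    Measure X := ((S.card : ENNReal)⁻¹) • ∑ h ∈ S, Measure.dirac (φ h)

lemma empMeas_apply {G X : Type} [MeasurableSpace X] (S : Finset G) (hS : S.Nonempty) (φ : G → X)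
    (C : Set X) (hC : MeasurableSet C) :
    empMeas S φ C = ENNReal.ofReal
      (((S.filter (fun g => g ∈ φ ⁻¹' C)).card : ℝ) / (S.card : ℝ)) := by
  have hpos : (0 : ℝ) < S.card := by exact_mod_cast hS.card_pos
  rw [ENNReal.ofReal_div_of_pos hpos, ENNReal.ofReal_natCast, ENNReal.ofReal_natCast]
  simp only [empMeas, Measure.smul_apply, Measure.finsetSum_apply, smul_eq_mul,
    Measure.dirac_apply' _ hC]
  rw [ENNReal.div_eq_inv_mul]
  congr 1
  simp [Set.indicator_apply]

lemma empMeas_prob {G X : Type} [MeasurableSpace X] (S : Finset G) (hS : S.Nonempty) (φ : G → X) :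
    IsProbabilityMeasure (empMeas S φ) := by
  constructor
  rw [empMeas_apply S hS φ _ MeasurableSet.univ]
  have hpos : (0 : ℝ) < S.card := by exact_mod_cast hS.card_pos
  simp [div_self hpos.ne']

lemma empMeas_integral {G X : Type} [MeasurableSpace X] (S : Finset G) (φ : G → X)
    (f : X → ℝ) (hf : StronglyMeasurable f) :
    ∫ x, f x ∂(empMeas S φ) = (S.card : ℝ)⁻¹ * ∑ h ∈ S, f (φ h) := by
  rw [empMeas, integral_smul_measure, integral_finsetSum_measure]
  · simp [integral_dirac' _ _ hf]
  · intro i _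
    exact integrable_dirac' hf (by simp)

theorem bergelson_correspondence (G : Type) [Group G] [Countable G]
    (I : ℕ → Finset G) (hI : IsFolnerSeq I)
    (E : Set G) (hE : 0 < upperDensityAlong I E) :
    ∃ (X : Type) (mX : MeasurableSpace X) (μ : Measure X) (T : G → X → X) (A : Set X),
      IsProbabilityMeasure μ ∧
      (∀ g : G, MeasurePreserving (T g) μ μ) ∧
      (∀ g h : G, T (g * h) = T g ∘ T h) ∧
      MeasurableSet[mX] A ∧
      μ A = ENNReal.ofReal (upperDensityAlong I E) ∧
      ∀ (k : ℕ) (g : Fin k → G),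
        μ (A ∩ ⋂ i : Fin k, T (g i) ⁻¹' A) ≤
          ENNReal.ofReal (upperDensityAlong I (E ∩ ⋂ i : Fin k, {h : G | g i * h ∈ E})) := by
  obtain ⟨hne, hfol⟩ := hI
  let T : G → (G → Bool) → (G → Bool) := fun g x h => x (h * g)
  let A : Set (G → Bool) := {x | x 1 = true}
  let φ : G → (G → Bool) := fun h k => decide (k * h ∈ E)
  have hTcont : ∀ g, Continuous (T g) := fun g => continuous_pi fun h => continuous_apply _
  have hTφ : ∀ g h, T g (φ h) = φ (g * h) := by
    intro g h; funext k; simp [T, φ, mul_assoc]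
  have hA : IsClopen A := (isClopen_discrete ({true} : Set Bool)).preimage (continuous_apply 1)
  let dens : Set G → ℕ → ℝ := fun F n =>
    (((I n).filter (fun g => g ∈ F)).card : ℝ) / ((I n).card : ℝ)
  have hd0 : ∀ F n, 0 ≤ dens F n := fun F n => by positivity
  have hd1 : ∀ F n, dens F n ≤ 1 := fun F n =>
    div_le_one_of_le₀ (by exact_mod_cast Finset.card_filter_le _ _) (by positivity)
  have hbdd : ∀ F, IsBoundedUnder (· ≤ ·) atTop (dens F) := fun F =>
    isBoundedUnder_of ⟨1, hd1 F⟩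
  have hcobdd : ∀ F, IsCoboundedUnder (· ≤ ·) atTop (dens F) := fun F =>
    (isBoundedUnder_of ⟨0, hd0 F⟩ : IsBoundedUnder (· ≥ ·) atTop (dens F)).isCoboundedUnder_le
  have hcl : MapClusterPt (upperDensityAlong I E) atTop (dens E) :=
    MapClusterPt.limsup (hcobdd E) (hbdd E)
  obtain ⟨U, hU, hUE⟩ := mapClusterPt_iff_ultrafilter.1 hcl
  let m : ℕ → ProbabilityMeasure (G → Bool) := fun n =>
    ⟨empMeas (I n) φ, empMeas_prob (I n) (hne n) φ⟩
  obtain ⟨μ, -, hμ⟩ := (isCompact_univ (X := ProbabilityMeasure (G → Bool))).ultrafilter_le_nhds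
    (U.map m) (by simp)
  have hμ : Tendsto m U (nhds μ) := hμ
  have hclop : ∀ C : Set (G → Bool), IsClopen C → Tendsto
      (fun n => ENNReal.ofReal (dens (φ ⁻¹' C) n)) U (nhds ((μ : Measure (G → Bool)) C)) := by
    intro C hC
    have := ProbabilityMeasure.tendsto_measure_of_null_frontier_of_tendsto' hμ
      (E := C) (by simp [hC.frontier_eq])
    refine this.congr fun n => ?_
    exact empMeas_apply (I n) (hne n) φ C hC.isOpen.measurableSet
  refine ⟨G → Bool, inferInstance, μ, T, A, inferInstance, ?_, ?_, hA.isOpen.measurableSet, ?_, ?_⟩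
  · intro g
    refine ⟨(hTcont g).measurable, ?_⟩
    haveI : IsProbabilityMeasure ((μ : Measure (G → Bool)).map (T g)) :=
      Measure.isProbabilityMeasure_map (hTcont g).measurable.aemeasurable
    apply ext_of_forall_integral_eq_of_IsFiniteMeasure
    intro f
    rw [integral_map (hTcont g).measurable.aemeasurable
      f.continuous.aestronglyMeasurable]
    have hlim := ProbabilityMeasure.tendsto_iff_forall_integral_tendsto.1 hμ
    have h1 := hlim f
    have h2 := hlim (f.compContinuous ⟨T g, hTcont g⟩)
    have h3 := h2.sub h1
    have h4 : Tendsto (fun n => ‖f‖ * ((((I n) ∆ ((I n).image (fun h => g * h))).card : ℝ) /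
        ((I n).card : ℝ))) U (nhds 0) := by
      have : Tendsto (fun n => ((((I n) ∆ ((I n).image (fun h => g * h))).card : ℝ) /
        ((I n).card : ℝ))) atTop (nhds 0) := by
        rw [Metric.tendsto_atTop]
        intro ε hε
        obtain ⟨M, hM⟩ := hfol g ε hε
        refine ⟨M, fun n hn => ?_⟩
        rw [Real.dist_eq, sub_zero, abs_of_nonneg (by positivity)]
        exact hM n hn
      simpa using (this.mono_left hU).const_mul ‖f‖
    have h6 : ∀ n, ‖(∫ x, f (T g x) ∂(empMeas (I n) φ)) - ∫ x, f x ∂(empMeas (I n) φ)‖ ≤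
        ‖f‖ * ((((I n) ∆ ((I n).image (fun h => g * h))).card : ℝ) / ((I n).card : ℝ)) := by
      intro n
      rw [empMeas_integral _ _ (fun x => f (T g x)) (f.continuous.comp (hTcont g)).stronglyMeasurable,
        empMeas_integral _ _ _ f.continuous.stronglyMeasurable, ← mul_sub, norm_mul,
        Real.norm_eq_abs, Real.norm_eq_abs, abs_of_nonneg (by positivity)]
      have := folner_sum_bound (I n) g (fun h => f (φ h)) ‖f‖ (fun x => f.norm_coe_le_norm _)
      simp only [hTφ]
      calc _ ≤ ((I n).card : ℝ)⁻¹ * _ := mul_le_mul_of_nonneg_left this (by positivity)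
        _ = _ := by ring
    have h5 := squeeze_zero_norm h6 h4
    exact sub_eq_zero.1 (tendsto_nhds_unique h3 h5)
  · intro g h
    funext x k
    simp [T, mul_assoc]
  · have h1 := hclop A hA
    have hEq : φ ⁻¹' A = E := by ext h; simp [φ, A]
    rw [hEq] at h1
    exact tendsto_nhds_unique h1 (ENNReal.tendsto_ofReal hUE)
  · intro k g
    have hC : IsClopen (A ∩ ⋂ i : Fin k, T (g i) ⁻¹' A) :=
      hA.inter (isClopen_iInter_of_finite fun i => hA.preimage (hTcont _))
    have h1 := hclop _ hC
    have hEq : φ ⁻¹' (A ∩ ⋂ i : Fin k, T (g i) ⁻¹' A) =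
        E ∩ ⋂ i : Fin k, {h : G | g i * h ∈ E} := by
      ext h; simp [φ, A, T]
    rw [hEq] at h1
    set F := E ∩ ⋂ i : Fin k, {h : G | g i * h ∈ E}
    obtain ⟨a, -, ha⟩ := (isCompact_Icc (a := (0:ℝ)) (b := 1)).ultrafilter_le_nhds
      (U.map (dens F)) (by
        simp only [Ultrafilter.coe_map, le_principal_iff]
        exact Filter.mem_map.2 (univ_mem' fun n => ⟨hd0 F n, hd1 F n⟩))
    have ha : Tendsto (dens F) U (nhds a) := ha
    rw [tendsto_nhds_unique h1 (ENNReal.tendsto_ofReal ha)]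
    apply ENNReal.ofReal_le_ofReal
    exact (mapClusterPt_iff_ultrafilter.2 ⟨U, hU, ha⟩ : MapClusterPt a atTop (dens F)).le_limsup
      (hbdd F)
end

section
/- Let E ⊆ ℤ^k have positive upper Banach density. Then there exist a dynamical system (Y, 𝔅, μ, T_1, …, T_k) (a probability measure space with k commuting invertible measurable measure-preserving transformations) and a set A ∈ 𝔅 with μ(A) > 0 such that for every finite set U of tuples in ℤ^k, the upper Banach density of ⋂_{n⃗∈U} (E − n⃗) is at least μ(⋂_{n⃗∈U} T_1^{n_1} ⋯ T_k^{n_k} A). -/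
open Filter MeasureTheory
open scoped Classical

/-- The upper Banach density of `E ⊆ ℤ^k`: the limsup of `|E ∩ B| / |B|` over boxes
`B = [M₁,N₁) × ⋯ × [M_k,N_k)` with `min_i (N_i - M_i) → ∞` (i.e. every side length
tends to infinity). -/
noncomputable def upperBanachDensityZk (k : ℕ) (E : Set (Fin k → ℤ)) : ℝ :=
  Filter.limsup
    (fun p : (Fin k → ℤ) × (Fin k → ℤ) =>
      (((Fintype.piFinset (fun i => Finset.Ico (p.1 i) (p.2 i))).filter
          (fun m => m ∈ E)).card : ℝ) / (∏ i : Fin k, ((p.2 i - p.1 i : ℤ) : ℝ)))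
    (Filter.comap (fun p : (Fin k → ℤ) × (Fin k → ℤ) => fun i => p.2 i - p.1 i)
      (Filter.atTop : Filter (Fin k → ℤ)))


open Topology

namespace Furst

variable {k : ℕ}

/-- The box with corners `p.1`, `p.2`. -/
noncomputable def box (p : (Fin k → ℤ) × (Fin k → ℤ)) : Finset (Fin k → ℤ) :=
  Fintype.piFinset (fun i => Finset.Ico (p.1 i) (p.2 i))

/-- The relative density of `E` in a box. -/
noncomputable def ratio (E : Set (Fin k → ℤ)) (p : (Fin k → ℤ) × (Fin k → ℤ)) : ℝ :=
  (((box p).filter (fun m => m ∈ E)).card : ℝ) / (∏ i : Fin k, ((p.2 i - p.1 i : ℤ) : ℝ))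

/-- The filter of boxes all of whose sides tend to infinity. -/
noncomputable def boxFilter (k : ℕ) : Filter ((Fin k → ℤ) × (Fin k → ℤ)) :=
  Filter.comap (fun p : (Fin k → ℤ) × (Fin k → ℤ) => fun i => p.2 i - p.1 i)
      (Filter.atTop : Filter (Fin k → ℤ))

theorem ubd_eq (E : Set (Fin k → ℤ)) :
    upperBanachDensityZk k E = limsup (ratio E) (boxFilter k) := rfl

instance : (boxFilter k).NeBot := by
  refine Filter.NeBot.comap_of_surj inferInstance ?_
  intro v
  exact ⟨(0, v), by simp⟩

theorem eventually_side (c : Fin k → ℤ) :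
    ∀ᶠ p in boxFilter k, ∀ i, c i ≤ p.2 i - p.1 i :=
  (Filter.tendsto_comap (f := fun p : (Fin k → ℤ) × (Fin k → ℤ) => fun i => p.2 i - p.1 i)).eventually
    (Filter.eventually_ge_atTop c)

theorem tendsto_side (i : Fin k) :
    Tendsto (fun p : (Fin k → ℤ) × (Fin k → ℤ) => ((p.2 i - p.1 i : ℤ) : ℝ)) (boxFilter k) atTop := by
  refine tendsto_intCast_atTop_atTop.comp ?_
  refine Filter.tendsto_atTop.2 fun b => ?_
  filter_upwards [eventually_side (fun _ : Fin k => b)] with p hp using hp i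

theorem card_box {p : (Fin k → ℤ) × (Fin k → ℤ)} (hp : ∀ i, 0 ≤ p.2 i - p.1 i) :
    ((box p).card : ℝ) = ∏ i : Fin k, ((p.2 i - p.1 i : ℤ) : ℝ) := by
  unfold box
  rw [Fintype.card_piFinset]
  push_cast
  refine Finset.prod_congr rfl fun i _ => ?_
  rw [Int.card_Ico]
  have := Int.toNat_of_nonneg (hp i)
  have h2 : (((p.2 i - p.1 i).toNat : ℤ) : ℝ) = ((p.2 i - p.1 i : ℤ) : ℝ) := by rw [this]
  push_cast at h2
  exact_mod_cast h2

theorem ratio_nonneg {p : (Fin k → ℤ) × (Fin k → ℤ)} (hp : ∀ i, 0 ≤ p.2 i - p.1 i)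
    (E : Set (Fin k → ℤ)) : 0 ≤ ratio E p := by
  unfold ratio
  rw [← card_box hp]
  positivity

theorem ratio_le_one {p : (Fin k → ℤ) × (Fin k → ℤ)} (hp : ∀ i, 0 ≤ p.2 i - p.1 i)
    (E : Set (Fin k → ℤ)) : ratio E p ≤ 1 := by
  unfold ratio
  rw [← card_box hp]
  refine div_le_one_of_le₀ ?_ (by positivity)
  exact_mod_cast Finset.card_filter_le _ _

theorem eventually_nonneg : ∀ᶠ p in boxFilter k, ∀ i, 0 ≤ p.2 i - p.1 i :=
  eventually_side (fun _ => 0)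

theorem bdd (E : Set (Fin k → ℤ)) :
    (boxFilter k).IsBoundedUnder (· ≤ ·) (ratio E) :=
  Filter.isBoundedUnder_of_eventually_le (a := 1)
    (eventually_nonneg.mono fun _ hp => ratio_le_one hp E)

theorem cobdd (E : Set (Fin k → ℤ)) (F : Filter ((Fin k → ℤ) × (Fin k → ℤ))) [F.NeBot]
    (hF : F ≤ boxFilter k) :
    F.IsCoboundedUnder (· ≤ ·) (ratio E) :=
  Filter.IsBoundedUnder.isCoboundedUnder_le
    (Filter.isBoundedUnder_of_eventually_ge (a := 0)
      (hF (eventually_nonneg.mono fun _ hp => ratio_nonneg hp E)))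

/-- Abstract counting: if `C ⊆ B` and `C ⊆ B'` with `B, B'` of the same size, the counts of `S`
in `B` and `B'` differ by at most `|B| - |C|`. -/
theorem count_diff {α : Type*} (B B' C : Finset α) (h : C ⊆ B) (h' : C ⊆ B')
    (P : α → Prop) :
    ((B.filter P).card : ℝ) - (B'.filter P).card ≤ B.card - C.card := by
  have h1 : (B.filter P).card ≤ (C.filter P).card + (B \ C).card := by
    refine (Finset.card_le_card ?_).trans (Finset.card_union_le _ _)
    intro x hx
    simp only [Finset.mem_filter, Finset.mem_union, Finset.mem_sdiff] at hx ⊢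
    tauto
  have h2 : (C.filter P).card ≤ (B'.filter P).card :=
    Finset.card_le_card (Finset.filter_subset_filter _ h')
  have h3 : (B \ C).card + C.card = B.card := Finset.card_sdiff_add_card_eq_card h
  have h1' : ((B.filter P).card : ℝ) ≤ (C.filter P).card + (B \ C).card := by exact_mod_cast h1
  have h2' : ((C.filter P).card : ℝ) ≤ (B'.filter P).card := by exact_mod_cast h2
  have h3' : ((B \ C).card : ℝ) + C.card = B.card := by exact_mod_cast h3
  linarith

theorem shift_count (S : Set (Fin k → ℤ)) (v : Fin k → ℤ) (p : (Fin k → ℤ) × (Fin k → ℤ)) :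
    ((box p).filter (fun m => m ∈ {m | m + v ∈ S})).card
      = ((box (p.1 + v, p.2 + v)).filter (fun m => m ∈ S)).card := by
  refine Finset.card_bij (fun m _ => m + v) ?_ ?_ ?_
  · intro m hm
    simpa [box] using hm
  · intro a _ b _ h
    simpa using h
  · intro b hb
    refine ⟨b - v, ?_, by simp⟩
    simp only [box, Finset.mem_filter, Fintype.mem_piFinset, Finset.mem_Ico, Pi.add_apply,
      Set.mem_ofPred_eq, Pi.sub_apply, sub_add_cancel] at hb ⊢
    refine ⟨fun i => ?_, hb.2⟩
    have := hb.1 i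
    omega

theorem shift_abs (S : Set (Fin k → ℤ)) (v : Fin k → ℤ) {p : (Fin k → ℤ) × (Fin k → ℤ)}
    (hp : ∀ i, 2 * |v i| + 1 ≤ p.2 i - p.1 i) :
    |ratio {m | m + v ∈ S} p - ratio S p| ≤
      1 - ∏ i, (1 - 2 * |(v i : ℝ)| / ((p.2 i - p.1 i : ℤ) : ℝ)) := by
  have hpos : ∀ i, 0 < p.2 i - p.1 i := fun i => by
    have := hp i; have := abs_nonneg (v i); omega
  have hposR : ∀ i, (0 : ℝ) < ((p.2 i - p.1 i : ℤ) : ℝ) := fun i => by exact_mod_cast hpos i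
  have hP : 0 < ∏ i, ((p.2 i - p.1 i : ℤ) : ℝ) := Finset.prod_pos fun i _ => hposR i
  set C := box (fun i => p.1 i + |v i|, fun i => p.2 i - |v i|) with hC
  have hCB : C ⊆ box p := by
    intro m hm
    simp only [hC, box, Fintype.mem_piFinset, Finset.mem_Ico] at hm ⊢
    intro i
    have := hm i; have := abs_nonneg (v i); omega
  have hCB' : C ⊆ box (p.1 + v, p.2 + v) := by
    intro m hm
    simp only [hC, box, Fintype.mem_piFinset, Finset.mem_Ico, Pi.add_apply] at hm ⊢
    intro i
    have := hm i; have := le_abs_self (v i); have := neg_abs_le (v i); omega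
  have c1 : ((box p).card : ℝ) = ∏ i, ((p.2 i - p.1 i : ℤ) : ℝ) := card_box fun i => (hpos i).le
  have c2 : ((box (p.1 + v, p.2 + v)).card : ℝ) = ∏ i, ((p.2 i - p.1 i : ℤ) : ℝ) := by
    rw [card_box]
    · refine Finset.prod_congr rfl fun i _ => ?_
      simp
    · intro i
      have := hpos i
      simp only [Pi.add_apply]; omega
  have c3 : (C.card : ℝ) = (∏ i, ((p.2 i - p.1 i : ℤ) : ℝ)) *
      ∏ i, (1 - 2 * |(v i : ℝ)| / ((p.2 i - p.1 i : ℤ) : ℝ)) := by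
    rw [hC, card_box, ← Finset.prod_mul_distrib]
    · refine Finset.prod_congr rfl fun i _ => ?_
      have := (hposR i).ne'
      rw [mul_sub, mul_div_cancel₀ _ this]
      push_cast
      ring
    · intro i
      have := hp i
      simp only; omega
  have d1 := count_diff (box p) (box (p.1 + v, p.2 + v)) C hCB hCB' (fun m => m ∈ S)
  have d2 := count_diff (box (p.1 + v, p.2 + v)) (box p) C hCB' hCB (fun m => m ∈ S)
  rw [c1, c3] at d1
  rw [c2, c3] at d2
  unfold ratio
  rw [shift_count, ← sub_div, abs_div, abs_of_pos hP, div_le_iff₀ hP, abs_le]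
  constructor <;> linarith

theorem shift_tendsto (S : Set (Fin k → ℤ)) (v : Fin k → ℤ) :
    Tendsto (fun p => ratio {m | m + v ∈ S} p - ratio S p) (boxFilter k) (𝓝 0) := by
  have h : Tendsto (fun p : (Fin k → ℤ) × (Fin k → ℤ) =>
      1 - ∏ i, (1 - 2 * |(v i : ℝ)| / ((p.2 i - p.1 i : ℤ) : ℝ))) (boxFilter k) (𝓝 0) := by
    have : Tendsto (fun p : (Fin k → ℤ) × (Fin k → ℤ) =>
      1 - ∏ i, (1 - 2 * |(v i : ℝ)| / ((p.2 i - p.1 i : ℤ) : ℝ))) (boxFilter k)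
        (𝓝 (1 - ∏ _i : Fin k, (1 - 0))) := by
      refine tendsto_const_nhds.sub (tendsto_finsetProd _ fun i _ => tendsto_const_nhds.sub ?_)
      exact tendsto_const_nhds.div_atTop (tendsto_side i)
    simpa using this
  refine squeeze_zero_norm' ?_ h
  filter_upwards [eventually_side (fun i => 2 * |v i| + 1)] with p hp
  exact shift_abs S v hp

/-- The shift space. -/
abbrev Y (k : ℕ) : Type := (Fin k → ℤ) → Bool

/-- The orbit of the indicator of `E`. -/
noncomputable def orb (E : Set (Fin k → ℤ)) (m : Fin k → ℤ) : Y k := fun n => decide (m + n ∈ E)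

/-- Cylinder sets. -/
def cyl (U : Finset (Fin k → ℤ)) : Set (Y k) := ⋂ n ∈ U, {y | y n = true}

theorem mem_cyl {U : Finset (Fin k → ℤ)} {y : Y k} : y ∈ cyl U ↔ ∀ n ∈ U, y n = true := by
  simp [cyl]

theorem isClopen_cyl (U : Finset (Fin k → ℤ)) : IsClopen (cyl U) := by
  refine isClopen_biInter_finset fun n _ => ?_
  exact (isClopen_discrete ({true} : Set Bool)).preimage (continuous_apply n)

theorem measurableSet_cyl (U : Finset (Fin k → ℤ)) : MeasurableSet (cyl U) :=
  (isClopen_cyl U).isClosed.measurableSet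

theorem generate_cyl : (MeasurableSpace.pi : MeasurableSpace (Y k)) =
    MeasurableSpace.generateFrom (Set.range cyl) := by
  apply le_antisymm
  · refine iSup_le fun n => ?_
    rw [← measurable_iff_comap_le]
    refine @measurable_to_bool _ (_) _ ?_
    refine MeasurableSpace.measurableSet_generateFrom ⟨{n}, ?_⟩
    ext y
    simp [cyl]
  · refine MeasurableSpace.generateFrom_le ?_
    rintro _ ⟨U, rfl⟩
    exact measurableSet_cyl U

theorem pi_cyl : IsPiSystem (Set.range (cyl (k := k))) := by
  rintro _ ⟨U, rfl⟩ _ ⟨V, rfl⟩ _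
  refine ⟨U ∪ V, ?_⟩
  ext y
  simp only [mem_cyl, Set.mem_inter_iff, Finset.mem_union]
  constructor
  · intro h
    exact ⟨fun n hn => h n (Or.inl hn), fun n hn => h n (Or.inr hn)⟩
  · rintro ⟨h1, h2⟩ n (hn | hn)
    · exact h1 n hn
    · exact h2 n hn

/-- Empirical measures. -/
noncomputable def emp (E : Set (Fin k → ℤ)) (p : (Fin k → ℤ) × (Fin k → ℤ)) :
    ProbabilityMeasure (Y k) :=
  if h : (box p).Nonempty then
    ⟨(PMF.uniformOfFinset (box p) h).toMeasure.map (orb E),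
      Measure.isProbabilityMeasure_map (measurable_of_countable _).aemeasurable⟩
  else ⟨Measure.dirac (fun _ => false), inferInstance⟩

/-- The set of `m` with `m + n ∈ E` for all `n ∈ U`. -/
def inter (E : Set (Fin k → ℤ)) (U : Finset (Fin k → ℤ)) : Set (Fin k → ℤ) :=
  ⋂ n ∈ U, {m : Fin k → ℤ | m + n ∈ E}

theorem emp_cyl (E : Set (Fin k → ℤ)) (U : Finset (Fin k → ℤ))
    {p : (Fin k → ℤ) × (Fin k → ℤ)} (hp : ∀ i, 1 ≤ p.2 i - p.1 i) :
    ((emp E p (cyl U) : NNReal) : ℝ) = ratio (inter E U) p := by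
  have hne : (box p).Nonempty := by
    refine ⟨p.1, ?_⟩
    simp only [box, Fintype.mem_piFinset, Finset.mem_Ico, le_refl, true_and]
    intro i
    have := hp i
    omega
  have hpre : orb E ⁻¹' (cyl U) = inter E U := by
    ext m
    simp [mem_cyl, orb, inter]
  unfold ratio
  rw [← card_box (fun i => by have := hp i; omega)]
  have he : emp E p = ⟨(PMF.uniformOfFinset (box p) hne).toMeasure.map (orb E),
      Measure.isProbabilityMeasure_map (measurable_of_countable _).aemeasurable⟩ := dif_pos hne
  rw [he]
  change (Measure.map (orb E) _ (cyl U)).toReal = _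
  rw [Measure.map_apply (measurable_of_countable _) (measurableSet_cyl U), hpre,
    PMF.toMeasure_uniformOfFinset_apply _ _ (Set.to_countable _).measurableSet]
  simp [ENNReal.toReal_div]

/-- The shift action. -/
def shift (n : Fin k → ℤ) (y : Y k) : Y k := fun m => y (m - n)

theorem shift_zero : shift (0 : Fin k → ℤ) = id := by
  funext y m
  simp [shift]

theorem shift_add (m n : Fin k → ℤ) : shift (m + n) = shift m ∘ shift n := by
  funext y l
  simp [shift, sub_sub]

theorem measurable_shift (n : Fin k → ℤ) : Measurable (shift n) :=
  measurable_pi_lambda _ fun m => measurable_pi_apply (m - n)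

theorem image_shift (n : Fin k → ℤ) : shift n '' (cyl {0}) = {y : Y k | y n = true} := by
  ext y
  simp only [Set.mem_image, mem_cyl, Finset.mem_singleton, forall_eq, Set.mem_ofPred_eq]
  constructor
  · rintro ⟨z, hz, rfl⟩
    simpa [shift] using hz
  · intro h
    refine ⟨shift (-n) y, by simpa [shift] using h, ?_⟩
    have := congrFun (shift_add n (-n)) y
    rw [add_neg_cancel, shift_zero] at this
    exact this.symm

theorem preimage_shift (n : Fin k → ℤ) (U : Finset (Fin k → ℤ)) :
    shift n ⁻¹' (cyl U) = cyl (U.image (fun u => u - n)) := by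
  ext y
  simp [mem_cyl, shift]

theorem inter_shift (E : Set (Fin k → ℤ)) (n : Fin k → ℤ) (U : Finset (Fin k → ℤ)) :
    inter E (U.image (fun u => u - n)) = {m | m + (-n) ∈ inter E U} := by
  ext m
  simp only [inter, Set.mem_iInter, Set.mem_ofPred_eq, Finset.forall_mem_image]
  refine forall₂_congr fun u _ => ?_
  rw [show m + (u - n) = m + -n + u by abel]

theorem exists_measure (E : Set (Fin k → ℤ)) (hE : 0 < upperBanachDensityZk k E) :
    ∃ (L : Filter ((Fin k → ℤ) × (Fin k → ℤ))) (μ : ProbabilityMeasure (Y k)),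
      L.NeBot ∧ L ≤ boxFilter k ∧
      (∀ᶠ p in L, upperBanachDensityZk k E / 2 ≤ ratio E p) ∧
      ∀ U, Tendsto (ratio (inter E U)) L (𝓝 ((μ (cyl U) : NNReal) : ℝ)) := by
  have hfreq : ∃ᶠ p in boxFilter k, upperBanachDensityZk k E / 2 < ratio E p :=
    frequently_lt_of_lt_limsup (cobdd E _ le_rfl) (by rw [← ubd_eq]; linarith)
  rw [Filter.frequently_iff_neBot] at hfreq
  let L := Ultrafilter.of (boxFilter k ⊓ 𝓟 {p | upperBanachDensityZk k E / 2 < ratio E p})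
  have hL : (L : Filter _) ≤ boxFilter k ⊓ 𝓟 {p | upperBanachDensityZk k E / 2 < ratio E p} :=
    Ultrafilter.of_le _
  obtain ⟨μ, -, hμ⟩ := isCompact_univ.ultrafilter_le_nhds (L.map (emp E)) (by simp)
  have hlim : Tendsto (emp E) L (𝓝 μ) := hμ
  refine ⟨L, μ, inferInstance, hL.trans inf_le_left, ?_, fun U => ?_⟩
  · have : {p | upperBanachDensityZk k E / 2 < ratio E p} ∈ (L : Filter _) :=
      (hL.trans inf_le_right) (Filter.mem_principal_self _)
    filter_upwards [this] with p hp using le_of_lt hp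
  · have := ProbabilityMeasure.tendsto_measure_of_isClopen_of_tendsto hlim (isClopen_cyl U)
    have := (NNReal.tendsto_coe.2 this)
    refine this.congr' ?_
    filter_upwards [(hL.trans inf_le_left) (eventually_side (fun _ : Fin k => 1))] with p hp
    exact emp_cyl E U hp

end Furst

open Furst in
/-- The multidimensional Furstenberg correspondence: if `E ⊆ ℤ^k` has positive upper
Banach density, there are a probability space with `k` commuting invertible
measure-preserving transformations (given as a measure-preserving `ℤ^k`-action `T`) and
a measurable set `A` with `μ A > 0` such that for every finite set `U` of tuples, the
upper Banach density of `⋂_{n⃗ ∈ U} (E - n⃗)` is at least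
`μ (⋂_{n⃗ ∈ U} T₁^{n₁} ⋯ T_k^{n_k} A)`. -/
theorem multidim_furstenberg_correspondence (k : ℕ) (E : Set (Fin k → ℤ))
    (hE : 0 < upperBanachDensityZk k E) :
    ∃ (Y : Type) (mY : MeasurableSpace Y) (μ : Measure Y)
      (T : (Fin k → ℤ) → Y → Y) (A : Set Y),
      IsProbabilityMeasure μ ∧
      (∀ n : Fin k → ℤ, MeasurePreserving (T n) μ μ) ∧
      T 0 = id ∧
      (∀ m n : Fin k → ℤ, T (m + n) = T m ∘ T n) ∧
      MeasurableSet[mY] A ∧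
      0 < μ A ∧
      ∀ U : Finset (Fin k → ℤ),
        μ (⋂ n ∈ U, T n '' A) ≤
          ENNReal.ofReal
            (upperBanachDensityZk k (⋂ n ∈ U, {m : Fin k → ℤ | m + n ∈ E})) := by
  obtain ⟨L, μ, hL, hLF, hpos, hlim⟩ := exists_measure E hE
  have hinv : ∀ n U, μ (cyl (U.image (fun u => u - n))) = μ (cyl U) := by
    intro n U
    have h1 := hlim (U.image (fun u => u - n))
    have h2 := hlim U
    rw [inter_shift] at h1
    have h3 := (shift_tendsto (inter E U) (-n)).mono_left hLF
    have h4 := tendsto_nhds_unique (h1.sub h2) h3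
    exact NNReal.coe_injective (sub_eq_zero.1 h4)
  have hcoe : ∀ s, (μ : Measure (Y k)) s = ENNReal.ofReal ((μ s : NNReal) : ℝ) := by
    intro s
    simp
  refine ⟨Y k, inferInstance, μ, shift, cyl {0}, inferInstance, ?_, shift_zero, shift_add,
    measurableSet_cyl _, ?_, ?_⟩
  · intro n
    refine ⟨measurable_shift n, ?_⟩
    have : IsProbabilityMeasure (Measure.map (shift n) (μ : Measure (Y k))) :=
      Measure.isProbabilityMeasure_map (measurable_shift n).aemeasurable
    refine ext_of_generate_finite _ generate_cyl pi_cyl ?_ (by simp)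
    rintro _ ⟨U, rfl⟩
    rw [Measure.map_apply (measurable_shift n) (measurableSet_cyl U), preimage_shift,
      hcoe, hcoe, hinv]
  · rw [hcoe, ENNReal.ofReal_pos]
    have h := hlim {0}
    have h0 : inter E {0} = E := by
      ext m
      simp [inter]
    rw [h0] at h
    have := ge_of_tendsto h hpos
    linarith
  · intro U
    have : (⋂ n ∈ U, shift n '' (cyl {0})) = cyl (k := k) U := by
      simp only [image_shift]
      rfl
    rw [this, hcoe]
    refine ENNReal.ofReal_le_ofReal ?_
    change _ ≤ upperBanachDensityZk k (inter E U)
    rw [ubd_eq, ← (hlim U).limsup_eq]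
    exact limsup_le_limsup_of_le hLF (cobdd _ L hLF) (bdd _)
end
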